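/- Let p, r be nonzero real numbers, let h = ℝ¹⁰ with basis (e₁,…,e₁₀) and Lie bracket determined by the non-vanishing relations [e₁,e₃] = −√(p²+r²) e₅, [e₁,e₄] = −√(p²+r²) e₆, [e₂,e₄] = −√(p²+r²) e₅, [e₂,e₃] = −√(p²+r²) e₆, [e₅,e₁] = p e₇, [e₅,e₂] = p e₈, [e₅,e₃] = r e₉, [e₅,e₄] = r e₁₀, [e₆,e₁] = p e₈, [e₆,e₂] = p e₇, [e₆,e₃] = r e₁₀, [e₆,e₄] = r e₉, and let ⟨·,·⟩ be the Lorentzian inner product for which (e₁,…,e₁₀) is orthonormal with ⟨e₅,e₅⟩ = −1. Then (h,⟨·,·⟩) is a Ricci-flat 3-step nilpotent Lorentzian Lie algebra whose center is Z(h) = span{e₇, e₈, e₉, e₁₀}, which is nondegenerate with respect to ⟨·,·⟩. -/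

import Mathlib

open Module LinearMap

noncomputable section

section PseudoOrthonormal

variable {ι H : Type*} [Fintype ι] [DecidableEq ι]

theorem sum_repr_of_pseudoOrthonormal [AddCommGroup H] [Module ℝ H]
    {b : Basis ι ℝ H} {B : H →ₗ[ℝ] H →ₗ[ℝ] ℝ} {ε : ι → ℝ}
    (hB : ∀ i j, B (b i) (b j) = if i = j then ε i else 0) (u v : H) :
    B u v = ∑ i, ε i * (b.repr u i * b.repr v i) := by
  conv_lhs => rw [← b.sum_repr u, ← b.sum_repr v]
  simp only [map_sum, map_smul, LinearMap.sum_apply, LinearMap.smul_apply, hB, smul_eq_mul,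
    mul_ite, mul_zero, Finset.sum_ite_eq', Finset.mem_univ, if_true]
  exact Finset.sum_congr rfl fun i _ => by ring

theorem repr_of_pseudoOrthonormal [AddCommGroup H] [Module ℝ H]
    {b : Basis ι ℝ H} {B : H →ₗ[ℝ] H →ₗ[ℝ] ℝ} {ε : ι → ℝ} (hε : ∀ i, ε i * ε i = 1)
    (hB : ∀ i j, B (b i) (b j) = if i = j then ε i else 0) (u : H) (i : ι) :
    b.repr u i = ε i * B u (b i) := by
  rw [sum_repr_of_pseudoOrthonormal hB]
  simp only [Basis.repr_self, Finsupp.single_apply, mul_ite, mul_one, mul_zero,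
    Finset.sum_ite_eq, Finset.mem_univ, if_true]
  rw [← mul_assoc, hε, one_mul]

theorem trace_of_pseudoOrthonormal [AddCommGroup H] [Module ℝ H]
    {b : Basis ι ℝ H} {B : H →ₗ[ℝ] H →ₗ[ℝ] ℝ} {ε : ι → ℝ} (hε : ∀ i, ε i * ε i = 1)
    (hB : ∀ i j, B (b i) (b j) = if i = j then ε i else 0) (f : Module.End ℝ H) :
    LinearMap.trace ℝ H f = ∑ i, ε i * B (f (b i)) (b i) := by
  rw [LinearMap.trace_eq_matrix_trace ℝ b]
  simp [Matrix.trace, LinearMap.toMatrix_apply, repr_of_pseudoOrthonormal hε hB]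

variable [LieRing H] [LieAlgebra ℝ H]
  {b : Basis ι ℝ H} {B : H →ₗ[ℝ] H →ₗ[ℝ] ℝ} {ε : ι → ℝ}

theorem trace_ad_comp_adjoint (hε : ∀ i, ε i * ε i = 1)
    (hB : ∀ i j, B (b i) (b j) = if i = j then ε i else 0)
    {adStar : H → Module.End ℝ H} (hadStar : ∀ u v w : H, B (adStar u v) w = B v ⁅u, w⁆)
    (u v : H) :
    LinearMap.trace ℝ H ((LieAlgebra.ad ℝ H u : Module.End ℝ H) ∘ₗ adStar v)
      = ∑ i, ε i * B ⁅u, b i⁆ ⁅v, b i⁆ := by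
  have := Module.Finite.of_basis b
  rw [LinearMap.trace_comp_comm', trace_of_pseudoOrthonormal hε hB]
  simp [hadStar]

theorem trace_J_comp_J (hε : ∀ i, ε i * ε i = 1)
    (hB : ∀ i j, B (b i) (b j) = if i = j then ε i else 0)
    {J : H → Module.End ℝ H} (hJ : ∀ u v w : H, B (J u v) w = B u ⁅v, w⁆)
    (u v : H) :
    LinearMap.trace ℝ H (J u ∘ₗ J v)
      = -∑ i, ∑ j, ε i * ε j * (B u ⁅b i, b j⁆ * B v ⁅b i, b j⁆) := by
  rw [trace_of_pseudoOrthonormal hε hB, ← Finset.sum_neg_distrib]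
  refine Finset.sum_congr rfl fun i _ => ?_
  have h : B u ⁅J v (b i), b i⁆ = ∑ j, ε j * B v ⁅b i, b j⁆ * B u ⁅b j, b i⁆ := by
    conv_lhs => rw [← b.sum_repr (J v (b i))]
    simp only [sum_lie, smul_lie, map_sum, map_smul, smul_eq_mul, repr_of_pseudoOrthonormal hε hB, hJ]
  rw [LinearMap.comp_apply, hJ, h, Finset.mul_sum, ← Finset.sum_neg_distrib]
  refine Finset.sum_congr rfl fun j _ => ?_
  rw [← lie_skew (b j) (b i), map_neg]
  ring

end PseudoOrthonormal

/-- Coordinates of the bracket of two vectors with coordinates `x` and `y`. -/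
def bracketCoords (s p r : ℝ) (x y : Fin 10 → ℝ) : Fin 10 → ℝ :=
  ![0, 0, 0, 0,
    -s * (x 0 * y 2 - x 2 * y 0 + x 1 * y 3 - x 3 * y 1),
    -s * (x 0 * y 3 - x 3 * y 0 + x 1 * y 2 - x 2 * y 1),
    p * (x 4 * y 0 - x 0 * y 4 + x 5 * y 1 - x 1 * y 5),
    p * (x 4 * y 1 - x 1 * y 4 + x 5 * y 0 - x 0 * y 5),
    r * (x 4 * y 2 - x 2 * y 4 + x 5 * y 3 - x 3 * y 5),
    r * (x 4 * y 3 - x 3 * y 4 + x 5 * y 2 - x 2 * y 5)]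

/-- The signs `⟨e_i, e_i⟩` of the Lorentzian orthonormal basis. -/
def lorentzSign (i : Fin 10) : ℝ := if i = 4 then -1 else 1

theorem lorentzSign_mul_self (i : Fin 10) : lorentzSign i * lorentzSign i = 1 := by
  unfold lorentzSign; split_ifs <;> norm_num

theorem sum_univ_ten {M : Type*} [AddCommMonoid M] (f : Fin 10 → M) :
    ∑ i, f i = f 0 + f 1 + f 2 + f 3 + f 4 + f 5 + f 6 + f 7 + f 8 + f 9 := by
  rw [Fin.sum_univ_castSucc, Fin.sum_univ_castSucc, Fin.sum_univ_eight]
  rfl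

theorem bracketCoords_single_eq_zero (s p r : ℝ) {i j : Fin 10} (hij : i < j)
    (h : (i, j) ∉ ({(0,2), (0,3), (1,2), (1,3), (0,4), (1,4), (2,4), (3,4),
      (0,5), (1,5), (2,5), (3,5)} : Set (Fin 10 × Fin 10))) :
    bracketCoords s p r (Pi.single i 1) (Pi.single j 1) = 0 := by
  simp only [Set.mem_insert_iff, Set.mem_singleton_iff, Prod.mk.injEq] at h
  fin_cases i <;> fin_cases j <;> first
    | exact absurd hij (by decide)
    | exact absurd h (by decide)
    | simp [bracketCoords]

theorem ricci_bracketCoords {s p r : ℝ} (hs : s ^ 2 = p ^ 2 + r ^ 2) (x y : Fin 10 → ℝ) :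
    2 * ∑ i, lorentzSign i * ∑ k, lorentzSign k *
        (bracketCoords s p r x (Pi.single i 1) k * bracketCoords s p r y (Pi.single i 1) k)
      = ∑ i, ∑ j, lorentzSign i * lorentzSign j *
        ((∑ k, lorentzSign k * (x k * bracketCoords s p r (Pi.single i 1) (Pi.single j 1) k)) *
        ∑ k, lorentzSign k * (y k * bracketCoords s p r (Pi.single i 1) (Pi.single j 1) k)) := by
  simp [lorentzSign, bracketCoords, sum_univ_ten]
  linear_combination (-4 * (x 4 * y 4 + x 5 * y 5)) * hs

section LieAlgebra

variable {H : Type*} [LieRing H] [LieAlgebra ℝ H] {b : Basis (Fin 10) ℝ H} {s p r : ℝ}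

theorem repr_lie_eq_bracketCoords
    (hb : ∀ i j, i < j →
      b.repr ⁅b i, b j⁆ = bracketCoords s p r (Pi.single i 1) (Pi.single j 1)) (u v : H) :
    ⇑(b.repr ⁅u, v⁆) = bracketCoords s p r (b.repr u) (b.repr v) := by
  have skew : ∀ x y, bracketCoords s p r y x = -bracketCoords s p r x y := by
    intro x y
    ext k
    fin_cases k <;> simp [bracketCoords] <;> ring
  have hb' : ∀ i j,
      ⇑(b.repr ⁅b i, b j⁆) = bracketCoords s p r (Pi.single i 1) (Pi.single j 1) := by
    intro i j
    rcases lt_trichotomy i j with h | rfl | h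
    · exact hb i j h
    · have := skew (Pi.single i 1) (Pi.single i 1)
      rw [lie_self, self_eq_neg.mp this]
      simp
    · rw [← lie_skew, map_neg, Finsupp.coe_neg, hb j i h, ← skew]
  have h : ⁅u, v⁆ = ∑ i, ∑ j, (b.repr u i * b.repr v j) • ⁅b i, b j⁆ := by
    conv_lhs => rw [← b.sum_repr u, ← b.sum_repr v]
    simp only [sum_lie, lie_sum, smul_lie, lie_smul, smul_smul, Finset.smul_sum]
    rw [Finset.sum_comm]
    simp only [mul_comm]
  ext k
  rw [h]
  simp only [map_sum, map_smul, Finsupp.coe_finsetSum, Finset.sum_apply, Finsupp.smul_apply,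
    smul_eq_mul, hb']
  fin_cases k <;> simp [bracketCoords, sum_univ_ten] <;> ring

variable (hbr : ∀ u v : H, ⇑(b.repr ⁅u, v⁆) = bracketCoords s p r (b.repr u) (b.repr v))
include hbr

theorem mem_center_iff_repr_eq_zero (hs : s ≠ 0) (hp : p ≠ 0) (z : H) :
    z ∈ LieAlgebra.center ℝ H ↔ ∀ i : Fin 10, i < 6 → b.repr z i = 0 := by
  rw [LieModule.mem_maxTrivSubmodule]
  constructor
  · intro h
    have h₀ : bracketCoords s p r (b.repr (b 0)) (b.repr z) = 0 := by rw [← hbr, h]; simp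
    have h₂ : bracketCoords s p r (b.repr (b 2)) (b.repr z) = 0 := by rw [← hbr, h]; simp
    have z0 := congrFun h₂ 4
    have z1 := congrFun h₂ 5
    have z2 := congrFun h₀ 4
    have z3 := congrFun h₀ 5
    have z4 := congrFun h₀ 6
    have z5 := congrFun h₀ 7
    simp [bracketCoords, hs, hp] at z0 z1 z2 z3 z4 z5
    intro i hi
    fin_cases i <;> first | assumption | simp at hi
  · intro h x
    have h0 := h 0 (by decide)
    have h1 := h 1 (by decide)
    have h2 := h 2 (by decide)
    have h3 := h 3 (by decide)
    have h4 := h 4 (by decide)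
    have h5 := h 5 (by decide)
    apply b.repr.injective
    ext k
    rw [hbr]
    fin_cases k <;> simp [bracketCoords, h0, h1, h2, h3, h4, h5]

theorem center_eq_span (hs : s ≠ 0) (hp : p ≠ 0) :
    (LieAlgebra.center ℝ H).toSubmodule = Submodule.span ℝ {b 6, b 7, b 8, b 9} := by
  apply le_antisymm
  · intro z hz
    have h := (mem_center_iff_repr_eq_zero hbr hs hp z).mp hz
    rw [← b.sum_repr z, sum_univ_ten, h 0 (by decide), h 1 (by decide), h 2 (by decide),
      h 3 (by decide), h 4 (by decide), h 5 (by decide)]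
    simp only [zero_smul, zero_add]
    have mem : ∀ w ∈ ({b 6, b 7, b 8, b 9} : Set H), ∀ a : ℝ,
        a • w ∈ Submodule.span ℝ {b 6, b 7, b 8, b 9} :=
      fun w hw a => Submodule.smul_mem _ _ (Submodule.subset_span hw)
    exact add_mem (add_mem (add_mem (mem _ (by simp) _) (mem _ (by simp) _))
      (mem _ (by simp) _)) (mem _ (by simp) _)
  · have key : ∀ j : Fin 10, 6 ≤ j → b j ∈ LieAlgebra.center ℝ H := fun j hj =>
      (mem_center_iff_repr_eq_zero hbr hs hp _).mpr fun i hi => by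
        rw [Basis.repr_self, Finsupp.single_eq_of_ne (hi.trans_le hj).ne]
    rw [Submodule.span_le]
    rintro z (rfl | rfl | rfl | rfl) <;> exact key _ (by decide)

theorem lowerCentralSeries_three_eq_bot (hs : s ≠ 0) (hp : p ≠ 0) :
    LieModule.lowerCentralSeries ℝ H H 3 = ⊥ := by
  let N : LieIdeal ℝ H :=
    { carrier := {z | ∀ i : Fin 10, i < 4 → b.repr z i = 0}
      add_mem' := fun hx hy i hi => by simp [hx i hi, hy i hi]
      zero_mem' := fun i _ => by simp
      smul_mem' := fun a x hx i hi => by simp [hx i hi]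
      lie_mem := fun {x m} _ i hi => by
        rw [hbr]
        fin_cases i <;> first | rfl | simp at hi }
  have h1 : LieModule.lowerCentralSeries ℝ H H 1 ≤ N := by
    rw [LieModule.lowerCentralSeries_succ, LieSubmodule.lieIdeal_oper_eq_span,
      LieSubmodule.lieSpan_le]
    rintro _ ⟨x, m, rfl⟩ i hi
    rw [hbr]
    fin_cases i <;> first | rfl | simp at hi
  have h2 : LieModule.lowerCentralSeries ℝ H H 2 ≤ LieAlgebra.center ℝ H := by
    rw [LieModule.lowerCentralSeries_succ, LieSubmodule.lieIdeal_oper_eq_span,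
      LieSubmodule.lieSpan_le]
    rintro _ ⟨x, m, rfl⟩
    refine (mem_center_iff_repr_eq_zero hbr hs hp _).mpr fun i hi => ?_
    have hm := h1 m.2
    have m0 := hm 0 (by decide)
    have m1 := hm 1 (by decide)
    have m2 := hm 2 (by decide)
    have m3 := hm 3 (by decide)
    rw [hbr]
    fin_cases i <;> first | rfl | (simp [bracketCoords, m0, m1, m2, m3]; done) | simp at hi
  rw [LieModule.lowerCentralSeries_succ, eq_bot_iff, LieSubmodule.lieIdeal_oper_eq_span,
    LieSubmodule.lieSpan_le]
  rintro _ ⟨x, m, rfl⟩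
  exact (LieModule.mem_maxTrivSubmodule ℝ H H _).mp (h2 m.2) x

theorem lowerCentralSeries_two_ne_bot (hs : s ≠ 0) (hp : p ≠ 0) :
    LieModule.lowerCentralSeries ℝ H H 2 ≠ ⊥ := by
  intro h
  have mem : ⁅b 0, ⁅b 0, b 2⁆⁆ ∈ LieModule.lowerCentralSeries ℝ H H 2 := by
    simp only [LieModule.lowerCentralSeries_succ, LieModule.lowerCentralSeries_zero]
    exact LieSubmodule.lie_mem_lie (LieSubmodule.mem_top _)
      (LieSubmodule.lie_mem_lie (LieSubmodule.mem_top _) (LieSubmodule.mem_top _))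
  rw [h, LieSubmodule.mem_bot] at mem
  have h6 : b.repr ⁅b 0, ⁅b 0, b 2⁆⁆ 6 = 0 := by rw [mem]; simp
  rw [hbr, hbr] at h6
  simp [bracketCoords, hs, hp] at h6

end LieAlgebra

/-- For nonzero `p, r ∈ ℝ`, the 10-dimensional Lie algebra with the given
structure constants and the Lorentzian metric making the basis orthonormal with
`⟨e₅,e₅⟩ = −1` is a Ricci-flat 3-step nilpotent Lorentzian Lie algebra with nondegenerate
center `span{e₇, e₈, e₉, e₁₀}`.  (Here `e₁,…,e₁₀` are `b 0, …, b 9`.) -/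
theorem statement18
    {H : Type*} [LieRing H] [LieAlgebra ℝ H] [Module.Finite ℝ H]
    (p r : ℝ) (hp : p ≠ 0) (hr : r ≠ 0)
    (b : Basis (Fin 10) ℝ H)
    -- the non-vanishing brackets
    (h13 : ⁅b 0, b 2⁆ = (- Real.sqrt (p^2 + r^2)) • b 4)
    (h14 : ⁅b 0, b 3⁆ = (- Real.sqrt (p^2 + r^2)) • b 5)
    (h24 : ⁅b 1, b 3⁆ = (- Real.sqrt (p^2 + r^2)) • b 4)
    (h23 : ⁅b 1, b 2⁆ = (- Real.sqrt (p^2 + r^2)) • b 5)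
    (h51 : ⁅b 4, b 0⁆ = p • b 6)
    (h52 : ⁅b 4, b 1⁆ = p • b 7)
    (h53 : ⁅b 4, b 2⁆ = r • b 8)
    (h54 : ⁅b 4, b 3⁆ = r • b 9)
    (h61 : ⁅b 5, b 0⁆ = p • b 7)
    (h62 : ⁅b 5, b 1⁆ = p • b 6)
    (h63 : ⁅b 5, b 2⁆ = r • b 9)
    (h64 : ⁅b 5, b 3⁆ = r • b 8)
    -- all other brackets of basis vectors vanish
    (hrest : ∀ i j : Fin 10, i < j →
      (i, j) ∉ ({(0,2), (0,3), (1,2), (1,3), (0,4), (1,4), (2,4), (3,4),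
        (0,5), (1,5), (2,5), (3,5)} : Set (Fin 10 × Fin 10)) → ⁅b i, b j⁆ = 0)
    -- the Lorentzian inner product making `b` orthonormal with `⟨e₅,e₅⟩ = −1`
    (B : H →ₗ[ℝ] H →ₗ[ℝ] ℝ)
    (hsymm : ∀ u v : H, B u v = B v u)
    (horth : ∀ i j : Fin 10, i ≠ j → B (b i) (b j) = 0)
    (htime : B (b 4) (b 4) = -1)
    (hspace : ∀ i : Fin 10, i ≠ 4 → B (b i) (b i) = 1)
    -- `adStar u` is the adjoint of `ad u` with respect to `B`
    (adStar : H → Module.End ℝ H)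
    (hadStar : ∀ u v w : H, B (adStar u v) w = B v ⁅u, w⁆)
    -- `Jm u` is the skew-symmetric endomorphism `J_u(v) = ad_v*(u)`
    (Jm : H → Module.End ℝ H)
    (hJm : ∀ u v w : H, B (Jm u v) w = B u ⁅v, w⁆) :
    -- `(h, ⟨·,·⟩)` is Ricci-flat ...
    (∀ u v : H,
      -(1/2) * LinearMap.trace ℝ H ((LieAlgebra.ad ℝ H u : Module.End ℝ H) ∘ₗ adStar v)
        - (1/4) * LinearMap.trace ℝ H (Jm u ∘ₗ Jm v) = 0) ∧
    -- ... 3-step nilpotent ...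
    (LieModule.lowerCentralSeries ℝ H H 3 = ⊥ ∧
      LieModule.lowerCentralSeries ℝ H H 2 ≠ ⊥) ∧
    -- ... with center `span{e₇, e₈, e₉, e₁₀}` ...
    (LieAlgebra.center ℝ H).toSubmodule
      = Submodule.span ℝ {b 6, b 7, b 8, b 9} ∧
    -- ... which is nondegenerate
    (∀ z ∈ LieAlgebra.center ℝ H,
      (∀ w ∈ LieAlgebra.center ℝ H, B z w = 0) → z = 0) := by
  set s := Real.sqrt (p ^ 2 + r ^ 2)
  have hs2 : s ^ 2 = p ^ 2 + r ^ 2 := Real.sq_sqrt (by positivity)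
  have hs : s ≠ 0 := (Real.sqrt_pos.mpr (by positivity)).ne'
  have hb : ∀ i j, i < j →
      ⇑(b.repr ⁅b i, b j⁆) = bracketCoords s p r (Pi.single i 1) (Pi.single j 1) := by
    have h15 := (lie_skew (b 0) (b 4)).symm
    have h25 := (lie_skew (b 1) (b 4)).symm
    have h35 := (lie_skew (b 2) (b 4)).symm
    have h45 := (lie_skew (b 3) (b 4)).symm
    have h16 := (lie_skew (b 0) (b 5)).symm
    have h26 := (lie_skew (b 1) (b 5)).symm
    have h36 := (lie_skew (b 2) (b 5)).symm
    have h46 := (lie_skew (b 3) (b 5)).symm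
    rw [h51] at h15
    rw [h52] at h25
    rw [h53] at h35
    rw [h54] at h45
    rw [h61] at h16
    rw [h62] at h26
    rw [h63] at h36
    rw [h64] at h46
    intro i j hij
    by_cases hmem : (i, j) ∈ ({(0,2), (0,3), (1,2), (1,3), (0,4), (1,4), (2,4), (3,4),
        (0,5), (1,5), (2,5), (3,5)} : Set (Fin 10 × Fin 10))
    · simp only [Set.mem_insert_iff, Set.mem_singleton_iff, Prod.mk.injEq] at hmem
      rcases hmem with h | h | h | h | h | h | h | h | h | h | h | h <;>
        obtain ⟨rfl, rfl⟩ := h <;>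
        simp only [h13, h14, h23, h24, h15, h25, h35, h45, h16, h26, h36, h46] <;>
        ext k <;> fin_cases k <;> simp [bracketCoords]
    · rw [hrest i j hij hmem, bracketCoords_single_eq_zero s p r hij hmem]
      simp
  have hbr := repr_lie_eq_bracketCoords hb
  have hB : ∀ i j, B (b i) (b j) = if i = j then lorentzSign i else 0 := by
    intro i j
    split_ifs with h
    · subst h
      by_cases hi : i = 4
      · simp [hi, htime, lorentzSign]
      · simp [hspace i hi, lorentzSign, hi]
    · exact horth i j h
  have hε := lorentzSign_mul_self
  refine ⟨fun u v => ?_, ⟨lowerCentralSeries_three_eq_bot hbr hs hp,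
    lowerCentralSeries_two_ne_bot hbr hs hp⟩, center_eq_span hbr hs hp, fun z hz hzw => ?_⟩
  · rw [trace_ad_comp_adjoint hε hB hadStar, trace_J_comp_J hε hB hJm]
    have h := ricci_bracketCoords hs2 (b.repr u) (b.repr v)
    simp only [sum_repr_of_pseudoOrthonormal hB, hbr, Basis.repr_self, Finsupp.single_eq_pi_single]
    linear_combination (-1 / 4) * h
  · have hz' := (mem_center_iff_repr_eq_zero hbr hs hp z).mp hz
    apply b.repr.injective
    ext i
    rw [map_zero, Finsupp.zero_apply]
    rcases lt_or_ge i 6 with hi | hi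
    · exact hz' i hi
    · rw [repr_of_pseudoOrthonormal hε hB, hzw (b i), mul_zero]
      refine (mem_center_iff_repr_eq_zero hbr hs hp _).mpr fun j hj => ?_
      rw [Basis.repr_self, Finsupp.single_eq_of_ne (hj.trans_le hi).ne]
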